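/- Let n ≥ 2 and let f : S^n → (0,∞) be a positive Lipschitz function, extended to ℝ^{n+1}\{0} as a function homogeneous of degree −1. Let u : ℝ^{n+1} → ℝ be continuous, homogeneous of degree 1, of class C² on ℝ^{n+1}\{0}, and satisfy Δu = f on ℝ^{n+1}\{0}. Then for every x ≠ 0 and all indices i, j ∈ {1, …, n+1}, the second partial derivative of u satisfies ∂²u/∂x_i∂x_j (x) = (1/ω_n) ∫_{ℝ^{n+1}} (x_j − y_j) ∂_{y_i} f(y) / |x − y|^{n+1} dy, where the integral is absolutely convergent (∂_{y_i} f exists almost everywhere by Rademacher's theorem). -/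

import Mathlib

open MeasureTheory Metric Set
open scoped RealInnerProductSpace

/-- The Euclidean Laplacian of `u : ℝ^m → ℝ`, as the sum of second partial
derivatives along the standard coordinate directions. -/
noncomputable def laplacian {m : ℕ} (u : EuclideanSpace ℝ (Fin m) → ℝ)
    (x : EuclideanSpace ℝ (Fin m)) : ℝ :=
  ∑ i, fderiv ℝ (fun y => fderiv ℝ u y (EuclideanSpace.single i 1)) x (EuclideanSpace.single i 1)

/-- The second partial derivative `∂²u/∂x_i∂x_j`. -/
noncomputable def secondPartial {m : ℕ} (u : EuclideanSpace ℝ (Fin m) → ℝ) (i j : Fin m)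
    (x : EuclideanSpace ℝ (Fin m)) : ℝ :=
  fderiv ℝ (fun y => fderiv ℝ u y (EuclideanSpace.single i 1)) x (EuclideanSpace.single j 1)

/-- `ω_n`, the total surface measure of the unit sphere `Sⁿ ⊂ ℝ^{n+1}`. -/
noncomputable def omega_n (n : ℕ) : ℝ :=
  ((volume : Measure (EuclideanSpace ℝ (Fin (n + 1)))).toSphere Set.univ).toReal

section IntegrationByParts

open Filter Topology Function

variable {E : Type*} [NormedAddCommGroup E] [NormedSpace ℝ E] [FiniteDimensional ℝ E]
  [MeasurableSpace E] [BorelSpace E] {μ : Measure E} [μ.IsAddHaarMeasure]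

/-- Integration by parts on an open set, for a locally Lipschitz function against a compactly
supported `C¹` function. -/
theorem LocallyLipschitzOn.integral_mul_fderiv_eq {h g : E → ℝ} {U : Set E} (hU : IsOpen U)
    (hh : LocallyLipschitzOn U h) (hg : ContDiff ℝ 1 g) (hgc : HasCompactSupport g)
    (hgU : tsupport g ⊆ U) (v : E) :
    ∫ y, g y * fderiv ℝ h y v ∂μ = -∫ y, fderiv ℝ g y v * h y ∂μ := by
  obtain ⟨K', hK'c, hKK', hK'U⟩ := exists_compact_between hgc.isCompact hU hgU
  obtain ⟨C, hC⟩ := (hh.mono hK'U).exists_lipschitzOnWith_of_compact hK'c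
  obtain ⟨H, hH, hHeq⟩ := hC.extend_real
  obtain ⟨D, hD⟩ : ∃ D, LipschitzWith D g :=
    ⟨_, (hg.lipschitzWith_of_hasCompactSupport hgc (by simp)).choose_spec⟩
  have key := hH.integral_lineDeriv_mul_eq (μ := μ) hD hgc v
  have e1 : ∫ y, g y * fderiv ℝ h y v ∂μ = ∫ y, lineDeriv ℝ H y v * g y ∂μ := by
    refine integral_congr_ae ?_
    filter_upwards [hH.ae_differentiableAt (μ := μ)] with y hy
    by_cases hyK : y ∈ tsupport g
    · have : h =ᶠ[𝓝 y] H := by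
        filter_upwards [mem_interior_iff_mem_nhds.1 (hKK' hyK)] with z hz using hHeq hz
      rw [hy.lineDeriv_eq_fderiv, this.fderiv_eq, mul_comm]
    · simp [image_eq_zero_of_notMem_tsupport hyK]
  have e2 : ∫ y, lineDeriv ℝ g y (-v) * H y ∂μ = -∫ y, fderiv ℝ g y v * h y ∂μ := by
    rw [← integral_neg]
    refine integral_congr_ae (Eventually.of_forall fun y => ?_)
    simp only
    rw [(hg.differentiable (by simp) y).lineDeriv_eq_fderiv]
    by_cases hyK : y ∈ tsupport g
    · rw [hHeq (interior_subset (hKK' hyK))]; simp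
    · have : fderiv ℝ g y = 0 := by
        by_contra hne
        exact hyK (support_fderiv_subset ℝ hne)
      simp [this]
  rw [e1, key, e2]

/-- Integration by parts on the whole space for a function that is locally Lipschitz away from
the origin, when the singularity and the growth at infinity are integrable. -/
theorem LocallyLipschitzOn.integral_mul_fderiv_eq_of_integrable [Nontrivial E] {h φ : E → ℝ}
    (hh : LocallyLipschitzOn {0}ᶜ h) (hφ : ContDiff ℝ 1 φ) (v : E)
    (h₁ : Integrable (fun y => φ y * h y / ‖y‖) μ)
    (h₂ : Integrable (fun y => φ y * fderiv ℝ h y v) μ)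
    (h₃ : Integrable (fun y => fderiv ℝ φ y v * h y) μ) :
    ∫ y, φ y * fderiv ℝ h y v ∂μ = -∫ y, fderiv ℝ φ y v * h y ∂μ := by
  let θ : ContDiffBump (0 : E) := ⟨1, 2, by norm_num, by norm_num⟩
  have hθ : ContDiff ℝ 1 θ := θ.contDiff
  have hdθ : Continuous fun w => fderiv ℝ θ w v := (hθ.continuous_fderiv (by simp)).clm_apply
    continuous_const
  have hdθ0 : ∀ w, 2 < ‖w‖ → fderiv ℝ θ w v = 0 := by
    intro w hw
    have : fderiv ℝ θ w = 0 := by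
      by_contra hne
      have := support_fderiv_subset ℝ hne
      rw [θ.tsupport_eq] at this
      simp only [mem_closedBall, dist_zero_right] at this
      exact absurd this (not_le.2 hw)
    simp [this]
  obtain ⟨M, hM⟩ : ∃ M, ∀ w, ‖fderiv ℝ θ w v * ‖w‖‖ ≤ M := by
    have hc : HasCompactSupport fun w => fderiv ℝ θ w v * ‖w‖ :=
      (θ.hasCompactSupport.fderiv_apply ℝ v).mul_right
    exact hc.exists_bound_of_continuous (hdθ.mul continuous_norm)
  let χ : ℕ → E → ℝ := fun m y => θ (((m : ℝ) + 2)⁻¹ • y) - θ (((m : ℝ) + 2) • y)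
  have hχ : ∀ m, ContDiff ℝ 1 (χ m) := fun m =>
    (hθ.comp (contDiff_const_smul _)).sub (hθ.comp (contDiff_const_smul _))
  have hdχ : ∀ m y, fderiv ℝ (χ m) y v = ((m : ℝ) + 2)⁻¹ * fderiv ℝ θ (((m : ℝ) + 2)⁻¹ • y) v
      - ((m : ℝ) + 2) * fderiv ℝ θ (((m : ℝ) + 2) • y) v := by
    intro m y
    have d1 : DifferentiableAt ℝ (fun y => θ (((m : ℝ) + 2)⁻¹ • y)) y :=
      ((hθ.comp (contDiff_const_smul _)).differentiable (by simp)) y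
    have d2 : DifferentiableAt ℝ (fun y => θ (((m : ℝ) + 2) • y)) y :=
      ((hθ.comp (contDiff_const_smul _)).differentiable (by simp)) y
    simp only [χ]
    rw [fderiv_fun_sub d1 d2, fderiv_comp_smul, fderiv_comp_smul]
    simp
  have hχ1 : ∀ m y, |χ m y| ≤ 1 := by
    intro m y
    simp only [χ]
    rw [abs_le]
    constructor <;>
    linarith [θ.nonneg' (((m : ℝ) + 2)⁻¹ • y), θ.nonneg' (((m : ℝ) + 2) • y),
      θ.le_one (x := ((m : ℝ) + 2)⁻¹ • y), θ.le_one (x := ((m : ℝ) + 2) • y)]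
  have hdχ1 : ∀ m y, y ≠ 0 → |fderiv ℝ (χ m) y v| ≤ 2 * M / ‖y‖ := by
    intro m y hy
    have hy' : 0 < ‖y‖ := norm_pos_iff.2 hy
    have hm : (0 : ℝ) < (m : ℝ) + 2 := by positivity
    have a1 := hM (((m : ℝ) + 2)⁻¹ • y)
    have a2 := hM (((m : ℝ) + 2) • y)
    have hmul : ∀ c : ℝ, |c| * ‖y‖ = |c * ‖y‖| := fun c => by rw [abs_mul, abs_norm]
    rw [le_div_iff₀ hy', hdχ, hmul, sub_mul]
    rw [norm_smul, Real.norm_eq_abs, Real.norm_eq_abs, abs_of_pos (inv_pos.2 hm)] at a1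
    rw [norm_smul, Real.norm_eq_abs, Real.norm_eq_abs, abs_of_pos hm] at a2
    refine (abs_sub _ _).trans ?_
    calc _ = _ := by congr 2 <;> ring
      _ ≤ M + M := add_le_add a1 a2
      _ = _ := by ring
  have hlim : ∀ y : E, y ≠ 0 → Tendsto (fun m : ℕ => ((m : ℝ) + 2) * ‖y‖) atTop atTop := fun y hy =>
    (tendsto_atTop_add_const_right _ _ tendsto_natCast_atTop_atTop).atTop_mul_const
      (norm_pos_iff.2 hy)
  have hlim0 : Tendsto (fun m : ℕ => ((m : ℝ) + 2)⁻¹) atTop (𝓝 0) :=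
    tendsto_inv_atTop_zero.comp
      (tendsto_atTop_add_const_right _ _ tendsto_natCast_atTop_atTop)
  have hlim0' : ∀ y : E, Tendsto (fun m : ℕ => ((m : ℝ) + 2)⁻¹ • y) atTop (𝓝 0) := fun y => by
    simpa using hlim0.smul_const y
  have hev : ∀ y : E, y ≠ 0 → ∀ᶠ m : ℕ in atTop, 2 < ‖((m : ℝ) + 2) • y‖ := by
    intro y hy
    filter_upwards [(hlim y hy).eventually_gt_atTop 2] with m hm
    rwa [norm_smul, Real.norm_eq_abs, abs_of_pos (by positivity)]
  have hχlim : ∀ y, y ≠ 0 → Tendsto (fun m => χ m y) atTop (𝓝 1) := by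
    intro y hy
    have t1 : Tendsto (fun m : ℕ => θ (((m : ℝ) + 2)⁻¹ • y)) atTop (𝓝 1) := by
      have := (θ.continuous.tendsto 0).comp (hlim0' y)
      rwa [θ.one_of_mem_closedBall (by simp [θ])] at this
    have t2 : Tendsto (fun m : ℕ => θ (((m : ℝ) + 2) • y)) atTop (𝓝 0) := by
      refine tendsto_const_nhds.congr' ?_
      filter_upwards [hev y hy] with m hm
      rw [θ.zero_of_le_dist (by simpa [θ] using hm.le)]
    simpa using t1.sub t2
  have hdχlim : ∀ y, y ≠ 0 → Tendsto (fun m => fderiv ℝ (χ m) y v) atTop (𝓝 0) := by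
    intro y hy
    simp only [hdχ]
    have t1 : Tendsto (fun m : ℕ => ((m : ℝ) + 2)⁻¹ * fderiv ℝ θ (((m : ℝ) + 2)⁻¹ • y) v)
        atTop (𝓝 0) := by
      simpa using hlim0.mul ((hdθ.tendsto 0).comp (hlim0' y))
    have t2 : Tendsto (fun m : ℕ => ((m : ℝ) + 2) * fderiv ℝ θ (((m : ℝ) + 2) • y) v)
        atTop (𝓝 0) := by
      refine tendsto_const_nhds.congr' ?_
      filter_upwards [hev y hy] with m hm
      rw [hdθ0 _ hm, mul_zero]
    simpa using t1.sub t2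
  have hne : ∀ᵐ y ∂μ, y ≠ 0 := by
    simp [ae_iff, measure_singleton]
  have hχc : ∀ m, HasCompactSupport (χ m) := by
    intro m
    have hm : ((m : ℝ) + 2) ≠ 0 := by positivity
    exact (θ.hasCompactSupport.comp_smul (inv_ne_zero hm)).sub (θ.hasCompactSupport.comp_smul hm)
  have hχU : ∀ m, tsupport (χ m) ⊆ {0}ᶜ := by
    intro m y hy
    rintro rfl
    refine notMem_tsupport_iff_eventuallyEq.2 ?_ hy
    have c1 : Tendsto (fun y : E => ((m : ℝ) + 2)⁻¹ • y) (𝓝 0) (𝓝 0) := by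
      simpa using (continuous_const_smul (((m : ℝ) + 2)⁻¹)).tendsto (0 : E)
    have c2 : Tendsto (fun y : E => ((m : ℝ) + 2) • y) (𝓝 0) (𝓝 0) := by
      simpa using (continuous_const_smul ((m : ℝ) + 2)).tendsto (0 : E)
    filter_upwards [c1.eventually θ.eventuallyEq_one, c2.eventually θ.eventuallyEq_one]
      with z h1 h2
    simp only [χ, h1, h2]
    simp
  have hstep : ∀ m, ∫ y, (χ m y * φ y) * fderiv ℝ h y v ∂μ
      = -∫ y, (χ m y * fderiv ℝ φ y v + fderiv ℝ (χ m) y v * φ y) * h y ∂μ := by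
    intro m
    have := hh.integral_mul_fderiv_eq (μ := μ) isOpen_compl_singleton ((hχ m).mul hφ)
      (hχc m).mul_right ((tsupport_mul_subset_left).trans (hχU m)) v
    rw [this]
    congr 2
    ext y
    rw [fderiv_fun_mul ((hχ m).differentiable (by simp) y) (hφ.differentiable (by simp) y)]
    simp [mul_comm]
  have hhm : AEStronglyMeasurable h μ := by
    have := hh.continuousOn.aestronglyMeasurable (μ := μ) (measurableSet_singleton 0).compl
    rwa [restrict_compl_singleton] at this
  have L1 : Tendsto (fun m => ∫ y, (χ m y * φ y) * fderiv ℝ h y v ∂μ) atTop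
      (𝓝 (∫ y, φ y * fderiv ℝ h y v ∂μ)) := by
    refine tendsto_integral_of_dominated_convergence _ (fun m => ?_) h₂.norm (fun m => ?_) ?_
    · simp_rw [mul_assoc]
      exact (hχ m).continuous.aestronglyMeasurable.mul h₂.aestronglyMeasurable
    · refine Eventually.of_forall fun y => ?_
      rw [mul_assoc, norm_mul]
      exact mul_le_of_le_one_left (norm_nonneg _) (hχ1 m y)
    · filter_upwards [hne] with y hy
      simpa [mul_assoc] using (hχlim y hy).mul_const (φ y * fderiv ℝ h y v)
  have L2 : Tendsto (fun m => ∫ y, (χ m y * fderiv ℝ φ y v + fderiv ℝ (χ m) y v * φ y) * h y ∂μ)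
      atTop (𝓝 (∫ y, fderiv ℝ φ y v * h y ∂μ)) := by
    refine tendsto_integral_of_dominated_convergence
      (fun y => ‖fderiv ℝ φ y v * h y‖ + (2 * M) * ‖φ y * h y / ‖y‖‖) (fun m => ?_)
      (h₃.norm.add (h₁.norm.const_mul _)) (fun m => ?_) ?_
    · refine AEStronglyMeasurable.mul (Continuous.aestronglyMeasurable ?_) hhm
      exact ((hχ m).continuous.mul ((hφ.continuous_fderiv (by simp)).clm_apply
        continuous_const)).add ((((hχ m).continuous_fderiv (by simp)).clm_apply
        continuous_const).mul hφ.continuous)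
    · filter_upwards [hne] with y hy
      rw [add_mul, mul_assoc, mul_assoc]
      refine (norm_add_le _ _).trans (add_le_add ?_ ?_)
      · rw [norm_mul]
        exact mul_le_of_le_one_left (norm_nonneg _) (hχ1 m y)
      · rw [norm_mul, norm_div, norm_norm]
        calc _ ≤ (2 * M / ‖y‖) * ‖φ y * h y‖ := by gcongr; exact hdχ1 m y hy
          _ = _ := by ring
    · filter_upwards [hne] with y hy
      simpa using (((hχlim y hy).mul_const (fderiv ℝ φ y v)).add
        ((hdχlim y hy).mul_const (φ y))).mul_const (h y)
  simp_rw [hstep] at L1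
  exact tendsto_nhds_unique L1 L2.neg

end IntegrationByParts

section Decay

open Filter Topology Module

variable {E : Type*} [NormedAddCommGroup E] [NormedSpace ℝ E] [FiniteDimensional ℝ E]
  [MeasurableSpace E] [BorelSpace E] {μ : Measure E} [μ.IsAddHaarMeasure]

theorem integrable_inv_one_add_norm_pow_mul_norm_pow [Nontrivial E] {a b : ℕ}
    (hb : b + 1 ≤ finrank ℝ E) (hab : a + b = finrank ℝ E + 1) :
    Integrable (fun y : E => ((1 + ‖y‖) ^ a * ‖y‖ ^ b)⁻¹) μ := by
  rw [integrable_fun_norm_addHaar μ (f := fun r : ℝ => ((1 + r) ^ a * r ^ b)⁻¹)]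
  have hint : IntegrableOn (fun r : ℝ => (r + 1) ^ (-2 : ℝ)) (Ioi 0) :=
    integrableOn_add_rpow_Ioi_of_lt (by norm_num) (by norm_num)
  refine Integrable.mono' hint (by fun_prop) ?_
  filter_upwards [ae_restrict_mem measurableSet_Ioi] with r hr
  have hr : 0 < r := hr
  obtain ⟨k, hk⟩ : ∃ k, finrank ℝ E - 1 = k + b := ⟨finrank ℝ E - 1 - b, by omega⟩
  obtain rfl : a = k + 2 := by omega
  rw [Real.norm_of_nonneg (by positivity), hk, Real.rpow_neg (by positivity), smul_eq_mul,
    Real.rpow_ofNat, ← div_eq_mul_inv, div_le_iff₀ (by positivity), ← div_eq_inv_mul,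
    le_div_iff₀ (by positivity), pow_add, pow_add]
  have : r ^ k ≤ (1 + r) ^ k := by gcongr; linarith
  calc r ^ k * r ^ b * (r + 1) ^ 2 ≤ (1 + r) ^ k * r ^ b * (r + 1) ^ 2 := by gcongr
    _ = _ := by ring

theorem integrable_mul_of_decay [Nontrivial E] {φ h : E → ℝ} {a b : ℕ} {C D : ℝ}
    (hb : b + 1 ≤ finrank ℝ E) (hab : a + b = finrank ℝ E + 1)
    (hφm : AEStronglyMeasurable φ μ) (hhm : AEStronglyMeasurable h μ)
    (hφ : ∀ y, |φ y| ≤ C * ((1 + ‖y‖) ^ a)⁻¹) (hh : ∀ y, y ≠ 0 → |h y| ≤ D * (‖y‖ ^ b)⁻¹) :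
    Integrable (fun y => φ y * h y) μ := by
  refine Integrable.mono' ((integrable_inv_one_add_norm_pow_mul_norm_pow (μ := μ) hb
    hab).const_mul (C * D)) (hφm.mul hhm) ?_
  have hne : ∀ᵐ y ∂μ, y ≠ 0 := by simp [ae_iff, measure_singleton]
  filter_upwards [hne] with y hy
  rw [norm_mul]
  calc _ ≤ (C * ((1 + ‖y‖) ^ a)⁻¹) * (D * (‖y‖ ^ b)⁻¹) :=
        mul_le_mul (hφ y) (hh y hy) (abs_nonneg _) ((abs_nonneg _).trans (hφ y))
    _ = _ := by rw [mul_inv]; ring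

end Decay

section Homogeneous

open Filter Topology

variable {E : Type*} [NormedAddCommGroup E] [NormedSpace ℝ E]

theorem fderiv_apply_smul_of_homogeneous {h : E → ℝ} {d : ℤ}
    (hh : ∀ t : ℝ, 0 < t → ∀ y : E, y ≠ 0 → h (t • y) = t ^ d * h y) (v : E) (t : ℝ) (ht : 0 < t)
    (y : E) (hy : y ≠ 0) : fderiv ℝ h (t • y) v = t ^ (d - 1) * fderiv ℝ h y v := by
  have h1 : fderiv ℝ (fun z => h (t • z)) y = fderiv ℝ (fun z => t ^ d • h z) y := by
    refine Filter.EventuallyEq.fderiv_eq ?_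
    filter_upwards [isOpen_compl_singleton.mem_nhds hy] with z hz
    exact hh t ht z hz
  have h2 : fderiv ℝ (fun z => t ^ d • h z) y = t ^ d • fderiv ℝ h y :=
    congrFun (fderiv_const_smul_field (t ^ d)) y
  rw [fderiv_comp_smul, h2] at h1
  have h3 := congrArg (fun L => L v) h1
  simp only [smul_apply, smul_eq_mul] at h3
  rw [zpow_sub_one₀ ht.ne', mul_right_comm, ← h3]
  field_simp

theorem abs_le_of_homogeneous {h : E → ℝ} {b : ℕ} {C : ℝ}
    (hh : ∀ t : ℝ, 0 < t → ∀ y : E, y ≠ 0 → h (t • y) = t ^ (-(b : ℤ)) * h y)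
    (hC : ∀ y ∈ sphere (0 : E) 1, |h y| ≤ C) (y : E) (hy : y ≠ 0) :
    |h y| ≤ C * (‖y‖ ^ b)⁻¹ := by
  have hy' : 0 < ‖y‖ := norm_pos_iff.2 hy
  have h1 := hh ‖y‖ hy' (‖y‖⁻¹ • y) (by simp [hy])
  rw [smul_inv_smul₀ hy'.ne'] at h1
  have h2 := hC (‖y‖⁻¹ • y) (by simp [norm_smul, hy])
  rw [h1, abs_mul, abs_of_pos (by positivity), zpow_neg, zpow_natCast, mul_comm]
  gcongr

theorem locallyLipschitzOn_of_homogeneous {f : E → ℝ} {K : NNReal} {M : ℝ}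
    (hf : LipschitzOnWith K f (sphere (0 : E) 1)) (hM : ∀ y ∈ sphere (0 : E) 1, |f y| ≤ M)
    (hom : ∀ t : ℝ, 0 < t → ∀ y : E, y ≠ 0 → f (t • y) = t⁻¹ * f y) :
    LocallyLipschitzOn {0}ᶜ f := by
  intro x hx
  have hx0 : 0 < ‖x‖ := norm_pos_iff.2 hx
  set r := ‖x‖ / 2 with hr
  have hr0 : 0 < r := by positivity
  have hfpolar : ∀ y : E, y ≠ 0 → f y = ‖y‖⁻¹ * f (‖y‖⁻¹ • y) := by
    intro y hy
    have hy' : 0 < ‖y‖ := norm_pos_iff.2 hy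
    have := hom ‖y‖ hy' (‖y‖⁻¹ • y) (by simp [hy])
    rwa [smul_inv_smul₀ hy'.ne'] at this
  refine ⟨Real.toNNReal ((M + 2 * K) / (r * r)), _,
    mem_nhdsWithin_of_mem_nhds (ball_mem_nhds x hr0), ?_⟩
  refine LipschitzOnWith.of_dist_le_mul fun a ha b hb => ?_
  have hnorm : ∀ a ∈ ball x r, r < ‖a‖ := by
    intro a ha
    rw [mem_ball, dist_eq_norm, norm_sub_rev] at ha
    have := norm_sub_norm_le x a
    linarith
  have ha' := hnorm a ha
  have hb' := hnorm b hb
  have pa : 0 < ‖a‖ := hr0.trans ha'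
  have pb : 0 < ‖b‖ := hr0.trans hb'
  have hM0 : 0 ≤ M := (abs_nonneg _).trans (hM (‖x‖⁻¹ • x) (by simp [norm_smul, hx0.ne']))
  have sa : ‖a‖⁻¹ • a ∈ sphere (0 : E) 1 := by simp [norm_smul, pa.ne']
  have sb : ‖b‖⁻¹ • b ∈ sphere (0 : E) 1 := by simp [norm_smul, pb.ne']
  have hinv : |‖a‖⁻¹ - ‖b‖⁻¹| ≤ ‖a - b‖ / (‖a‖ * ‖b‖) := by
    rw [inv_sub_inv pa.ne' pb.ne', abs_div, abs_of_pos (by positivity : 0 < ‖a‖ * ‖b‖)]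
    gcongr
    rw [norm_sub_rev]
    exact abs_norm_sub_norm_le b a
  have hdir : ‖‖a‖⁻¹ • a - ‖b‖⁻¹ • b‖ ≤ 2 * ‖a - b‖ / ‖a‖ := by
    have : ‖a‖⁻¹ • a - ‖b‖⁻¹ • b = ‖a‖⁻¹ • (a - b) + (‖a‖⁻¹ - ‖b‖⁻¹) • b := by
      rw [smul_sub, sub_smul]; abel
    rw [this]
    refine (norm_add_le _ _).trans ?_
    rw [norm_smul, norm_smul, Real.norm_eq_abs, Real.norm_eq_abs, abs_of_pos (inv_pos.2 pa)]
    calc _ ≤ ‖a‖⁻¹ * ‖a - b‖ + ‖a - b‖ / (‖a‖ * ‖b‖) * ‖b‖ := by gcongr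
      _ = _ := by field_simp; norm_num
  have hfd : |f (‖a‖⁻¹ • a) - f (‖b‖⁻¹ • b)| ≤ K * (2 * ‖a - b‖ / ‖a‖) := by
    have := hf.dist_le_mul _ sa _ sb
    rw [Real.dist_eq, dist_eq_norm] at this
    exact this.trans (by gcongr)
  rw [Real.dist_eq, dist_eq_norm, Real.coe_toNNReal _ (by positivity),
    hfpolar a (norm_pos_iff.1 pa), hfpolar b (norm_pos_iff.1 pb)]
  calc |‖a‖⁻¹ * f (‖a‖⁻¹ • a) - ‖b‖⁻¹ * f (‖b‖⁻¹ • b)|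
      = |(‖a‖⁻¹ - ‖b‖⁻¹) * f (‖a‖⁻¹ • a) + ‖b‖⁻¹ * (f (‖a‖⁻¹ • a) - f (‖b‖⁻¹ • b))| := by
        congr 1; ring
    _ ≤ |‖a‖⁻¹ - ‖b‖⁻¹| * |f (‖a‖⁻¹ • a)| + ‖b‖⁻¹ * |f (‖a‖⁻¹ • a) - f (‖b‖⁻¹ • b)| := by
        refine (abs_add_le _ _).trans ?_
        rw [abs_mul, abs_mul, abs_of_pos (inv_pos.2 pb)]
    _ ≤ ‖a - b‖ / (‖a‖ * ‖b‖) * M + ‖b‖⁻¹ * (K * (2 * ‖a - b‖ / ‖a‖)) := by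
        gcongr; exact hM _ sa
    _ = (M + 2 * K) / (‖a‖ * ‖b‖) * ‖a - b‖ := by field_simp
    _ ≤ _ := by gcongr

theorem ContDiffOn.fderiv_apply_compl_zero {u : E → ℝ} (hu : ContDiffOn ℝ 2 u {0}ᶜ) (v : E) :
    ContDiffOn ℝ 1 (fun y => fderiv ℝ u y v) {0}ᶜ :=
  (hu.fderiv_of_isOpen isOpen_compl_singleton (by norm_num)).clm_apply contDiffOn_const

theorem ContDiffOn.locallyLipschitzOn_of_isOpen {h : E → ℝ} {U : Set E} (hU : IsOpen U)
    (hh : ContDiffOn ℝ 1 h U) : LocallyLipschitzOn U h := by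
  intro x hx
  obtain ⟨K, t, ht, hK⟩ := (hh.contDiffAt (hU.mem_nhds hx)).exists_lipschitzOnWith
  exact ⟨K, t, mem_nhdsWithin_of_mem_nhds ht, hK⟩

theorem exists_decay_of_homogeneous [FiniteDimensional ℝ E] {h : E → ℝ} {b : ℕ}
    (hl : LocallyLipschitzOn {0}ᶜ h)
    (hh : ∀ t : ℝ, 0 < t → ∀ y : E, y ≠ 0 → h (t • y) = t ^ (-(b : ℤ)) * h y) (v : E) :
    (∃ D, ∀ y, y ≠ 0 → |h y| ≤ D * (‖y‖ ^ b)⁻¹) ∧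
      ∃ D, ∀ y, y ≠ 0 → |fderiv ℝ h y v| ≤ D * (‖y‖ ^ (b + 1))⁻¹ := by
  have := FiniteDimensional.proper_real E
  have hsub : sphere (0 : E) 1 ⊆ {0}ᶜ := fun y hy h0 => by
    rw [mem_singleton_iff.1 h0] at hy
    simp at hy
  constructor
  · obtain ⟨D, hD⟩ := (isCompact_sphere (0 : E) 1).exists_bound_of_continuousOn
      (hl.continuousOn.mono hsub)
    exact ⟨D, fun y hy => abs_le_of_homogeneous hh hD y hy⟩
  · obtain ⟨K, hK, hsK, hK0⟩ := exists_compact_between (isCompact_sphere (0 : E) 1)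
      isOpen_compl_singleton hsub
    obtain ⟨C, hC⟩ := (hl.mono hK0).exists_lipschitzOnWith_of_compact hK
    refine ⟨C * ‖v‖, fun y hy => abs_le_of_homogeneous (h := fun y => fderiv ℝ h y v)
      (b := b + 1) (fun t ht y hy => ?_) (fun y hy => ?_) y hy⟩
    · rw [fderiv_apply_smul_of_homogeneous hh v t ht y hy]
      congr 2
      push_cast
      ring
    · refine ((fderiv ℝ h y).le_opNorm v).trans ?_
      gcongr
      exact norm_fderiv_le_of_lipschitzOn ℝ (mem_interior_iff_mem_nhds.1 (hsK hy)) hC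

end Homogeneous

section Mass

open Filter Topology Module

theorem integral_pow_div_sqrt_pow (n : ℕ) :
    ∫ r in Ioi (0 : ℝ), r ^ n * ((n + 1) / √(r ^ 2 + 1) ^ (n + 3)) = 1 := by
  have hs : ∀ r : ℝ, 0 < √(r ^ 2 + 1) := fun r => by positivity
  have hd : ∀ r : ℝ, HasDerivAt (fun r : ℝ => (r / √(r ^ 2 + 1)) ^ (n + 1))
      (r ^ n * ((n + 1) / √(r ^ 2 + 1) ^ (n + 3))) r := by
    intro r
    have h1 : HasDerivAt (fun r : ℝ => √(r ^ 2 + 1)) (r / √(r ^ 2 + 1)) r := by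
      have := ((hasDerivAt_pow 2 r).add_const 1).sqrt (by positivity)
      convert this using 1
      have := (hs r).ne'
      simp
      field_simp
    have h2 := ((hasDerivAt_id r).div h1 (hs r).ne').pow (n + 1)
    refine HasDerivAt.congr_deriv h2 ?_
    have h3 := Real.sq_sqrt (show 0 ≤ r ^ 2 + 1 by positivity)
    simp only [Nat.add_sub_cancel, div_pow, Pi.div_apply, id_eq]
    have := (hs r).ne'
    push_cast
    field_simp
    rw [h3]
    ring
  have hlim : Tendsto (fun r : ℝ => (r / √(r ^ 2 + 1)) ^ (n + 1)) atTop (𝓝 1) := by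
    have h1 : Tendsto (fun r : ℝ => (√(1 + (r⁻¹) ^ 2))⁻¹ ^ (n + 1)) atTop (𝓝 1) := by
      have : Continuous fun s : ℝ => (√(1 + s ^ 2))⁻¹ ^ (n + 1) := by
        refine Continuous.pow (Continuous.inv₀ (by fun_prop) fun s => ?_) _
        have : 0 < √(1 + s ^ 2) := by positivity
        exact this.ne'
      have h0 := (this.tendsto 0).comp tendsto_inv_atTop_zero
      simpa [Function.comp_def] using h0
    refine h1.congr' ?_
    filter_upwards [eventually_gt_atTop 0] with r hr
    congr 1
    rw [show (1 : ℝ) + r⁻¹ ^ 2 = (r ^ 2 + 1) / r ^ 2 by field_simp, Real.sqrt_div (by positivity),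
      Real.sqrt_sq hr.le, inv_div]
  have := integral_Ioi_of_hasDerivAt_of_nonneg' (a := 0) (fun r _ => hd r)
    (fun r hr => by have : (0 : ℝ) < r := hr; positivity) hlim
  rw [this]
  simp

theorem integral_poisson_kernel (n : ℕ) :
    ∫ z : EuclideanSpace ℝ (Fin (n + 1)), (n + 1 : ℝ) / √(‖z‖ ^ 2 + 1) ^ (n + 3)
      = omega_n n := by
  rw [integral_fun_norm_addHaar volume (fun r : ℝ => (n + 1 : ℝ) / √(r ^ 2 + 1) ^ (n + 3)),
    omega_n, Measure.toSphere_apply_univ]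
  simp only [finrank_euclideanSpace, Fintype.card_fin, Nat.add_sub_cancel, smul_eq_mul]
  rw [integral_pow_div_sqrt_pow]
  rw [ENNReal.toReal_mul, ENNReal.toReal_natCast, nsmul_eq_mul, Measure.real, mul_one]

theorem omega_n_pos (n : ℕ) : 0 < omega_n n := by
  rw [omega_n, Measure.toSphere_apply_univ]
  refine ENNReal.toReal_pos ?_ ?_
  · exact mul_ne_zero (by simp) (measure_ball_pos _ _ one_pos).ne'
  · exact ENNReal.mul_ne_top (by simp) measure_ball_lt_top.ne

end Mass

section Kernel

open Filter Topology

variable {n : ℕ}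

theorem Integrable.integral_mul_fderiv_eq_of_decay {φ h : EuclideanSpace ℝ (Fin (n + 1)) → ℝ}
    {a b : ℕ} {C C' D D' : ℝ} (v : EuclideanSpace ℝ (Fin (n + 1))) (hb : b + 1 ≤ n)
    (hab : a + b = n + 1) (hφ : ContDiff ℝ 1 φ) (hh : LocallyLipschitzOn {0}ᶜ h)
    (hφC : ∀ y, |φ y| ≤ C * ((1 + ‖y‖) ^ a)⁻¹)
    (hφC' : ∀ y, |fderiv ℝ φ y v| ≤ C' * ((1 + ‖y‖) ^ (a + 1))⁻¹)
    (hhD : ∀ y, y ≠ 0 → |h y| ≤ D * (‖y‖ ^ b)⁻¹)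
    (hhD' : ∀ y, y ≠ 0 → |fderiv ℝ h y v| ≤ D' * (‖y‖ ^ (b + 1))⁻¹) :
    Integrable (fun y => φ y * fderiv ℝ h y v) ∧ Integrable (fun y => fderiv ℝ φ y v * h y) ∧
      ∫ y, φ y * fderiv ℝ h y v = -∫ y, fderiv ℝ φ y v * h y := by
  have hhm : AEStronglyMeasurable h volume := by
    have := hh.continuousOn.aestronglyMeasurable (μ := volume) (measurableSet_singleton 0).compl
    rwa [restrict_compl_singleton] at this
  have hφm : AEStronglyMeasurable φ volume := hφ.continuous.aestronglyMeasurable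
  have h1 : Integrable (fun y => φ y * (h y / ‖y‖)) := by
    refine integrable_mul_of_decay (a := a) (b := b + 1) (C := C) (D := D) (by simpa using hb)
      (by simp; omega) hφm
      (hhm.div₀ continuous_norm.aestronglyMeasurable) hφC fun y hy => ?_
    have : 0 < ‖y‖ := norm_pos_iff.2 hy
    rw [abs_div, abs_norm, div_le_iff₀ this]
    refine (hhD y hy).trans (le_of_eq ?_)
    field_simp
    ring
  have h2 : Integrable (fun y => φ y * fderiv ℝ h y v) :=
    integrable_mul_of_decay (a := a) (b := b + 1) (by simpa using hb) (by simp; omega) hφm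
      (measurable_fderiv_apply_const ℝ h v).aestronglyMeasurable hφC hhD'
  have h3 : Integrable (fun y => fderiv ℝ φ y v * h y) :=
    integrable_mul_of_decay (a := a + 1) (b := b) (by simp; omega) (by simp; omega)
      (measurable_fderiv_apply_const ℝ φ v).aestronglyMeasurable hhm hφC' hhD
  refine ⟨h2, h3, hh.integral_mul_fderiv_eq_of_integrable hφ v ?_ h2 h3⟩
  simpa only [mul_div_assoc] using h1

/-- The regularized distance `(|x - y|² + ε²)^{1/2}`. -/
noncomputable def regDist (x : EuclideanSpace ℝ (Fin (n + 1))) (ε : ℝ)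
    (y : EuclideanSpace ℝ (Fin (n + 1))) : ℝ :=
  √(‖x - y‖ ^ 2 + ε ^ 2)

/-- The regularization of the gradient of the fundamental solution. -/
noncomputable def regGrad (x : EuclideanSpace ℝ (Fin (n + 1))) (ε : ℝ) (j : Fin (n + 1))
    (y : EuclideanSpace ℝ (Fin (n + 1))) : ℝ :=
  (x j - y j) / regDist x ε y ^ (n + 1)

/-- The Hessian of the regularized fundamental solution. -/
noncomputable def regHess (x : EuclideanSpace ℝ (Fin (n + 1))) (ε : ℝ) (i j : Fin (n + 1))
    (y : EuclideanSpace ℝ (Fin (n + 1))) : ℝ :=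
  (if i = j then 1 else 0) / regDist x ε y ^ (n + 1)
    - (n + 1) * (x i - y i) * (x j - y j) / regDist x ε y ^ (n + 3)

/-- The third derivatives of the regularized fundamental solution. -/
noncomputable def regThird (x : EuclideanSpace ℝ (Fin (n + 1))) (ε : ℝ) (i j k : Fin (n + 1))
    (y : EuclideanSpace ℝ (Fin (n + 1))) : ℝ :=
  -(n + 1) * ((if i = j then 1 else 0) * (x k - y k) + (if i = k then 1 else 0) * (x j - y j)
      + (if j = k then 1 else 0) * (x i - y i)) / regDist x ε y ^ (n + 3)
    + (n + 1) * (n + 3) * (x i - y i) * (x j - y j) * (x k - y k) / regDist x ε y ^ (n + 5)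

theorem regThird_swap (x : EuclideanSpace ℝ (Fin (n + 1))) (ε : ℝ) (i j k : Fin (n + 1)) :
    regThird x ε i j k = regThird x ε k j i := by
  ext y
  simp only [regThird, eq_comm (a := k), eq_comm (a := j) (b := i)]
  ring

theorem regThird_swap' (x : EuclideanSpace ℝ (Fin (n + 1))) (ε : ℝ) (i j k : Fin (n + 1)) :
    regThird x ε i j k = regThird x ε i k j := by
  ext y
  simp only [regThird, eq_comm (a := k) (b := j)]
  ring

section

variable {x : EuclideanSpace ℝ (Fin (n + 1))} {ε : ℝ}

theorem regDist_pos (hε : 0 < ε) (y : EuclideanSpace ℝ (Fin (n + 1))) : 0 < regDist x ε y := by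
  unfold regDist; positivity

theorem norm_sub_le_regDist (y : EuclideanSpace ℝ (Fin (n + 1))) : ‖x - y‖ ≤ regDist x ε y :=
  Real.le_sqrt_of_sq_le (by nlinarith [sq_nonneg ε])

theorem le_regDist (y : EuclideanSpace ℝ (Fin (n + 1))) : ε ≤ regDist x ε y :=
  Real.le_sqrt_of_sq_le (by nlinarith [sq_nonneg ‖x - y‖])

theorem abs_sub_apply_le_norm (y : EuclideanSpace ℝ (Fin (n + 1))) (j : Fin (n + 1)) :
    |x j - y j| ≤ ‖x - y‖ := by
  simpa using PiLp.norm_apply_le (x - y) j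

theorem abs_sub_apply_le_regDist (y : EuclideanSpace ℝ (Fin (n + 1))) (j : Fin (n + 1)) :
    |x j - y j| ≤ regDist x ε y :=
  (abs_sub_apply_le_norm y j).trans (norm_sub_le_regDist y)

theorem contDiff_regDist (hε : 0 < ε) : ContDiff ℝ 1 (regDist x ε) := by
  unfold regDist
  refine ContDiff.sqrt ?_ fun y => by positivity
  exact ((contDiff_const.sub contDiff_id).norm_sq ℝ).add contDiff_const

theorem contDiff_sub_apply (j : Fin (n + 1)) :
    ContDiff ℝ 1 fun y : EuclideanSpace ℝ (Fin (n + 1)) => x j - y j := by fun_prop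

theorem contDiff_regGrad (hε : 0 < ε) (j : Fin (n + 1)) : ContDiff ℝ 1 (regGrad x ε j) := by
  unfold regGrad
  exact (contDiff_sub_apply j).div ((contDiff_regDist hε).pow _)
    fun y => (pow_pos (regDist_pos hε y) _).ne'

theorem contDiff_regHess (hε : 0 < ε) (i j : Fin (n + 1)) : ContDiff ℝ 1 (regHess x ε i j) := by
  unfold regHess
  refine (contDiff_const.div ((contDiff_regDist hε).pow _)
    fun y => (pow_pos (regDist_pos hε y) _).ne').sub ?_
  exact ((contDiff_const.mul (contDiff_sub_apply i)).mul (contDiff_sub_apply j)).div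
    ((contDiff_regDist hε).pow _) fun y => (pow_pos (regDist_pos hε y) _).ne'

theorem hasLineDerivAt_regDist (hε : 0 < ε) (y : EuclideanSpace ℝ (Fin (n + 1)))
    (k : Fin (n + 1)) :
    HasLineDerivAt ℝ (regDist x ε) (-(x k - y k) / regDist x ε y) y
      (EuclideanSpace.single k 1) := by
  unfold HasLineDerivAt
  have h0 : HasDerivAt (fun t : ℝ => x - (y + t • EuclideanSpace.single k (1 : ℝ)))
      (-EuclideanSpace.single k (1 : ℝ)) 0 := by
    simpa using (((hasDerivAt_id (0 : ℝ)).smul_const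
      (EuclideanSpace.single k (1 : ℝ))).const_add y).const_sub x
  have h1 := (h0.norm_sq.add_const (ε ^ 2)).sqrt (by positivity)
  refine HasDerivAt.congr_deriv h1 ?_
  simp only [zero_smul, add_zero, inner_neg_right, EuclideanSpace.inner_single_right, regDist]
  simp
  field_simp

theorem hasLineDerivAt_sub_apply (y : EuclideanSpace ℝ (Fin (n + 1))) (j k : Fin (n + 1)) :
    HasLineDerivAt ℝ (fun y : EuclideanSpace ℝ (Fin (n + 1)) => x j - y j)
      (-(if j = k then 1 else 0)) y (EuclideanSpace.single k 1) := by
  unfold HasLineDerivAt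
  have h0 : HasDerivAt (fun t : ℝ => x j - (y j + t * (if j = k then 1 else 0)))
      (-(if j = k then 1 else 0)) 0 := by
    simpa using (((hasDerivAt_id (0 : ℝ)).mul_const
      (if j = k then (1 : ℝ) else 0)).const_add (y j)).const_sub (x j)
  simpa using h0

theorem fderiv_regGrad (hε : 0 < ε) (y : EuclideanSpace ℝ (Fin (n + 1))) (i j : Fin (n + 1)) :
    fderiv ℝ (regGrad x ε j) y (EuclideanSpace.single i 1) = -regHess x ε i j y := by
  rw [← ((contDiff_regGrad hε j).differentiable (by simp) y).lineDeriv_eq_fderiv]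
  refine HasLineDerivAt.lineDeriv ?_
  have hr := (regDist_pos (x := x) hε y).ne'
  have h1 := hasLineDerivAt_regDist (x := x) hε y i
  have h2 := hasLineDerivAt_sub_apply (x := x) y j i
  unfold HasLineDerivAt at h1 h2 ⊢
  refine HasDerivAt.congr_deriv (h2.div (h1.pow (n + 1)) (by simpa using hr)) ?_
  simp only [zero_smul, add_zero, regHess, eq_comm (a := i), Nat.add_sub_cancel]
  push_cast
  field_simp
  ring

theorem fderiv_regHess (hε : 0 < ε) (y : EuclideanSpace ℝ (Fin (n + 1)))
    (i j k : Fin (n + 1)) :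
    fderiv ℝ (regHess x ε i j) y (EuclideanSpace.single k 1) = -regThird x ε i j k y := by
  rw [← ((contDiff_regHess hε i j).differentiable (by simp) y).lineDeriv_eq_fderiv]
  refine HasLineDerivAt.lineDeriv ?_
  have hr := (regDist_pos (x := x) hε y).ne'
  have h1 := hasLineDerivAt_regDist (x := x) hε y k
  have h2 := hasLineDerivAt_sub_apply (x := x) y i k
  have h3 := hasLineDerivAt_sub_apply (x := x) y j k
  unfold HasLineDerivAt at h1 h2 h3 ⊢
  refine HasDerivAt.congr_deriv (((hasDerivAt_const (0 : ℝ) (if i = j then (1 : ℝ) else 0)).div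
    (h1.pow (n + 1)) (by simpa using hr)).sub
    (((h2.const_mul ((n : ℝ) + 1)).mul h3).div (h1.pow (n + 3)) (by simpa using hr))) ?_
  simp only [zero_smul, add_zero, regThird, Pi.pow_apply, Pi.mul_apply,
    show n + 3 - 1 = n + 2 by omega, Nat.add_sub_cancel]
  push_cast
  field_simp
  ring

theorem inv_regDist_pow_le (hε : 0 < ε) (y : EuclideanSpace ℝ (Fin (n + 1))) (a : ℕ) :
    (regDist x ε y ^ a)⁻¹ ≤ ((1 + ‖x‖) / ε + 1) ^ a * ((1 + ‖y‖) ^ a)⁻¹ := by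
  have hr := regDist_pos (x := x) hε y
  have h1 : 1 + ‖y‖ ≤ ((1 + ‖x‖) / ε + 1) * regDist x ε y := by
    have h2 := norm_sub_norm_le y x
    rw [norm_sub_rev] at h2
    have h3 := norm_sub_le_regDist (x := x) (ε := ε) y
    have h4 : 1 + ‖x‖ ≤ (1 + ‖x‖) / ε * regDist x ε y := by
      rw [div_mul_eq_mul_div, le_div_iff₀ hε]
      gcongr
      exact le_regDist y
    linarith
  rw [inv_eq_one_div, div_le_iff₀ (by positivity), mul_right_comm, ← mul_pow, ← div_eq_mul_inv,
    one_le_div (by positivity)]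
  gcongr

theorem abs_regGrad_le (hε : 0 < ε) (y : EuclideanSpace ℝ (Fin (n + 1))) (j : Fin (n + 1)) :
    |regGrad x ε j y| ≤ (regDist x ε y ^ n)⁻¹ := by
  have hr := regDist_pos (x := x) hε y
  rw [regGrad, abs_div, abs_of_pos (pow_pos hr _), div_le_iff₀ (pow_pos hr _), pow_succ,
    inv_mul_cancel_left₀ (pow_pos hr _).ne']
  exact abs_sub_apply_le_regDist y j

theorem abs_regHess_le (hε : 0 < ε) (y : EuclideanSpace ℝ (Fin (n + 1))) (i j : Fin (n + 1)) :
    |regHess x ε i j y| ≤ (n + 2) * (regDist x ε y ^ (n + 1))⁻¹ := by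
  have hr := regDist_pos (x := x) hε y
  have hi := abs_sub_apply_le_regDist (x := x) (ε := ε) y i
  have hj := abs_sub_apply_le_regDist (x := x) (ε := ε) y j
  have h1 : |(if i = j then 1 else 0 : ℝ)| ≤ 1 := by split_ifs <;> simp
  refine (abs_sub _ _).trans ?_
  simp only [abs_div, abs_mul, abs_of_pos (pow_pos hr _)]
  rw [abs_of_nonneg (by positivity : (0 : ℝ) ≤ (n : ℝ) + 1)]
  calc _ ≤ 1 / regDist x ε y ^ (n + 1)
        + (n + 1) * regDist x ε y * regDist x ε y / regDist x ε y ^ (n + 3) := by gcongr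
    _ = _ := by field_simp; ring

theorem abs_regThird_le (hε : 0 < ε) (y : EuclideanSpace ℝ (Fin (n + 1)))
    (i j k : Fin (n + 1)) :
    |regThird x ε i j k y| ≤ ((n + 1) * (n + 6)) * (regDist x ε y ^ (n + 2))⁻¹ := by
  have hr := regDist_pos (x := x) hε y
  have hi := abs_sub_apply_le_regDist (x := x) (ε := ε) y i
  have hj := abs_sub_apply_le_regDist (x := x) (ε := ε) y j
  have hk := abs_sub_apply_le_regDist (x := x) (ε := ε) y k
  have h1 : ∀ i j : Fin (n + 1), |(if i = j then 1 else 0 : ℝ)| ≤ 1 := fun i j => by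
    split_ifs <;> simp
  refine (abs_add_le _ _).trans ?_
  have h3 : |(if i = j then 1 else 0) * (x k - y k) + (if i = k then 1 else 0) * (x j - y j)
      + (if j = k then 1 else 0) * (x i - y i)| ≤ 3 * regDist x ε y := by
    refine (abs_add_three _ _ _).trans ?_
    simp only [abs_mul]
    calc _ ≤ 1 * regDist x ε y + 1 * regDist x ε y + 1 * regDist x ε y := by
          gcongr <;> exact h1 _ _
      _ = _ := by ring
  rw [abs_div, abs_mul, abs_div]
  simp only [abs_mul, abs_of_pos (pow_pos hr _), abs_neg]
  rw [abs_of_nonneg (by positivity : (0 : ℝ) ≤ (n : ℝ) + 1),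
    abs_of_nonneg (by positivity : (0 : ℝ) ≤ (n : ℝ) + 3)]
  calc _ ≤ (n + 1) * (3 * regDist x ε y) / regDist x ε y ^ (n + 3)
        + (n + 1) * (n + 3) * regDist x ε y * regDist x ε y * regDist x ε y
          / regDist x ε y ^ (n + 5) := by gcongr
    _ = _ := by field_simp; ring

theorem sum_regHess (hε : 0 < ε) (y : EuclideanSpace ℝ (Fin (n + 1))) :
    ∑ k, regHess x ε k k y = (n + 1) * ε ^ 2 / regDist x ε y ^ (n + 3) := by
  have hr := regDist_pos (x := x) hε y
  have hsq : regDist x ε y ^ 2 = ‖x - y‖ ^ 2 + ε ^ 2 := Real.sq_sqrt (by positivity)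
  have hn : ‖x - y‖ ^ 2 = ∑ k, (x k - y k) * (x k - y k) := by
    rw [EuclideanSpace.real_norm_sq_eq]
    simp [sq]
  simp only [regHess, if_true, Finset.sum_sub_distrib, mul_assoc, ← Finset.sum_div,
    ← Finset.mul_sum, ← hn]
  rw [show ‖x - y‖ ^ 2 = regDist x ε y ^ 2 - ε ^ 2 by rw [hsq]; ring]
  simp only [Finset.sum_const, Finset.card_univ, Fintype.card_fin, nsmul_eq_mul]
  push_cast
  field_simp
  ring

end

theorem one_add_norm_le_of_half_norm_le {x y : EuclideanSpace ℝ (Fin (n + 1))} (hx : x ≠ 0)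
    (hxy : ‖x‖ / 2 ≤ ‖x - y‖) : 1 + ‖y‖ ≤ (2 * (1 + ‖x‖) / ‖x‖ + 1) * ‖x - y‖ := by
  have hx0 : 0 < ‖x‖ := norm_pos_iff.2 hx
  have h2 := norm_sub_norm_le y x
  rw [norm_sub_rev] at h2
  have h4 : 1 + ‖x‖ ≤ 2 * (1 + ‖x‖) / ‖x‖ * ‖x - y‖ := by
    rw [div_mul_eq_mul_div, le_div_iff₀ hx0]
    nlinarith
  linarith

theorem half_norm_le_of_sub_lt {x y : EuclideanSpace ℝ (Fin (n + 1))}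
    (hxy : ‖x - y‖ < ‖x‖ / 2) : ‖x‖ / 2 ≤ ‖y‖ := by
  have := norm_sub_norm_le x y
  linarith

theorem integrable_kernel_mul {g : EuclideanSpace ℝ (Fin (n + 1)) → ℝ} {D : ℝ} (hn : 2 ≤ n)
    {x : EuclideanSpace ℝ (Fin (n + 1))} (hx : x ≠ 0) (j : Fin (n + 1)) (hg : Measurable g)
    (hD : ∀ y, y ≠ 0 → |g y| ≤ D * (‖y‖ ^ 2)⁻¹) :
    Integrable fun y => (x j - y j) * g y / ‖x - y‖ ^ (n + 1) := by
  have hx0 : 0 < ‖x‖ := norm_pos_iff.2 hx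
  have hD0 : 0 ≤ D := by
    have := (abs_nonneg _).trans (hD x hx)
    by_contra hneg
    have : D * (‖x‖ ^ 2)⁻¹ < 0 := mul_neg_of_neg_of_pos (not_le.1 hneg) (by positivity)
    linarith
  have h1 : Integrable fun y : EuclideanSpace ℝ (Fin (n + 1)) =>
      ((1 + ‖y‖) ^ n * ‖y‖ ^ 2)⁻¹ :=
    integrable_inv_one_add_norm_pow_mul_norm_pow (by simpa using hn) (by simp)
  have h2 : Integrable fun y : EuclideanSpace ℝ (Fin (n + 1)) =>
      ((1 + ‖x - y‖) ^ 2 * ‖x - y‖ ^ n)⁻¹ :=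
    (integrable_inv_one_add_norm_pow_mul_norm_pow (a := 2) (b := n)
      (μ := (volume : Measure (EuclideanSpace ℝ (Fin (n + 1))))) (by simp)
      (by simp; omega)).comp_sub_left x
  set A := 2 * (1 + ‖x‖) / ‖x‖ + 1 with hA
  have hA0 : 0 < A := by positivity
  refine Integrable.mono' ((h1.const_mul (D * A ^ n)).add
    (h2.const_mul (D * ((‖x‖ / 2) ^ 2)⁻¹ * (1 + ‖x‖ / 2) ^ 2))) ?_ ?_
  · have : Measurable fun y : EuclideanSpace ℝ (Fin (n + 1)) => x j - y j :=
      (contDiff_sub_apply j).continuous.measurable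
    exact ((this.mul hg).div (by fun_prop)).aestronglyMeasurable
  have hne : ∀ᵐ y : EuclideanSpace ℝ (Fin (n + 1)), y ≠ 0 := by simp [ae_iff, measure_singleton]
  have hne' : ∀ᵐ y : EuclideanSpace ℝ (Fin (n + 1)), y ≠ x := by
    simp [ae_iff, measure_singleton]
  filter_upwards [hne, hne'] with y hy hyx
  have hy0 : 0 < ‖y‖ := norm_pos_iff.2 hy
  have hxy : 0 < ‖x - y‖ := norm_pos_iff.2 (sub_ne_zero.2 hyx.symm)
  have hbase : ‖(x j - y j) * g y / ‖x - y‖ ^ (n + 1)‖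
      ≤ D * (‖y‖ ^ 2)⁻¹ * (‖x - y‖ ^ n)⁻¹ := by
    rw [Real.norm_eq_abs, abs_div, abs_mul, abs_of_pos (pow_pos hxy _)]
    calc _ ≤ ‖x - y‖ * (D * (‖y‖ ^ 2)⁻¹) / ‖x - y‖ ^ (n + 1) := by
          gcongr
          · exact abs_sub_apply_le_norm y j
          · exact hD y hy
      _ = _ := by field_simp; ring
  refine hbase.trans ?_
  simp only [Pi.add_apply]
  rcases le_or_gt (‖x‖ / 2) ‖x - y‖ with hc | hc
  · refine le_add_of_le_of_nonneg ?_ (by positivity)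
    have h3 := one_add_norm_le_of_half_norm_le hx hc
    have h4 : (‖x - y‖ ^ n)⁻¹ ≤ A ^ n * ((1 + ‖y‖) ^ n)⁻¹ := by
      rw [← div_eq_mul_inv, le_div_iff₀ (by positivity), inv_mul_le_iff₀ (by positivity),
        ← mul_pow, mul_comm]
      gcongr
    calc _ ≤ D * (‖y‖ ^ 2)⁻¹ * (A ^ n * ((1 + ‖y‖) ^ n)⁻¹) := by gcongr
      _ = _ := by rw [mul_inv]; ring
  · refine le_add_of_nonneg_of_le (by positivity) ?_
    have h3 := half_norm_le_of_sub_lt hc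
    have h4 : 1 ≤ (1 + ‖x‖ / 2) ^ 2 * ((1 + ‖x - y‖) ^ 2)⁻¹ := by
      rw [← div_eq_mul_inv, one_le_div (by positivity)]
      gcongr
    calc D * (‖y‖ ^ 2)⁻¹ * (‖x - y‖ ^ n)⁻¹
        ≤ D * ((‖x‖ / 2) ^ 2)⁻¹ * (‖x - y‖ ^ n)⁻¹ := by gcongr
      _ ≤ D * ((‖x‖ / 2) ^ 2)⁻¹ * (‖x - y‖ ^ n)⁻¹
          * ((1 + ‖x‖ / 2) ^ 2 * ((1 + ‖x - y‖) ^ 2)⁻¹) :=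
          le_mul_of_one_le_right (by positivity) h4
      _ = _ := by rw [mul_inv]; ring

theorem tendsto_integral_regGrad_mul {g : EuclideanSpace ℝ (Fin (n + 1)) → ℝ}
    {x : EuclideanSpace ℝ (Fin (n + 1))} (j : Fin (n + 1)) (hg : Measurable g)
    (hint : Integrable fun y => (x j - y j) * g y / ‖x - y‖ ^ (n + 1)) :
    Tendsto (fun c : ℝ => ∫ y, regGrad x c⁻¹ j y * g y) atTop
      (𝓝 (∫ y, (x j - y j) * g y / ‖x - y‖ ^ (n + 1))) := by
  have hne' : ∀ᵐ y : EuclideanSpace ℝ (Fin (n + 1)), y ≠ x := by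
    simp [ae_iff, measure_singleton]
  refine tendsto_integral_filter_of_dominated_convergence _ ?_ ?_ hint.norm ?_
  · filter_upwards [eventually_gt_atTop 0] with c hc
    exact ((contDiff_regGrad (inv_pos.2 hc) j).continuous.measurable.mul hg).aestronglyMeasurable
  · filter_upwards [eventually_gt_atTop 0] with c hc
    filter_upwards [hne'] with y hyx
    have hxy : 0 < ‖x - y‖ := norm_pos_iff.2 (sub_ne_zero.2 hyx.symm)
    rw [regGrad, div_mul_eq_mul_div, norm_div, norm_div, norm_pow, norm_pow, norm_norm,
      Real.norm_of_nonneg (regDist_pos (inv_pos.2 hc) y).le]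
    gcongr
    exact norm_sub_le_regDist y
  · filter_upwards [hne'] with y hyx
    have hxy : 0 < ‖x - y‖ := norm_pos_iff.2 (sub_ne_zero.2 hyx.symm)
    have hlim : Tendsto (fun c : ℝ => regDist x c⁻¹ y) atTop (𝓝 ‖x - y‖) := by
      have hc : Continuous fun ε => regDist x ε y := by unfold regDist; fun_prop
      have := (hc.tendsto 0).comp tendsto_inv_atTop_zero
      have h0 : regDist x 0 y = ‖x - y‖ := by simp [regDist]
      rwa [h0] at this
    simp only [regGrad, div_mul_eq_mul_div]
    exact tendsto_const_nhds.div (hlim.pow _) (by positivity)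

theorem tendsto_integral_poisson_mul {g : EuclideanSpace ℝ (Fin (n + 1)) → ℝ} {D : ℝ}
    (hn : 1 ≤ n) {x : EuclideanSpace ℝ (Fin (n + 1))} (hx : x ≠ 0) (hg : Measurable g)
    (hgx : ContinuousAt g x) (hD : ∀ y, y ≠ 0 → |g y| ≤ D * ‖y‖⁻¹) :
    Tendsto (fun c : ℝ => ∫ y, (n + 1) * c⁻¹ ^ 2 / regDist x c⁻¹ y ^ (n + 3) * g y) atTop
      (𝓝 (omega_n n * g x)) := by
  have hx0 : 0 < ‖x‖ := norm_pos_iff.2 hx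
  have hD0 : 0 ≤ D := by
    have := (abs_nonneg _).trans (hD x hx)
    by_contra hneg
    have : D * ‖x‖⁻¹ < 0 := mul_neg_of_neg_of_pos (not_le.1 hneg) (by positivity)
    linarith
  have hω := omega_n_pos n
  set B := ball x (‖x‖ / 2) with hB
  have hBm : MeasurableSet B := measurableSet_ball
  have hxB : x ∈ B := mem_ball_self (by positivity)
  have hint₁ : Integrable (B.indicator g) := by
    rw [integrable_indicator_iff hBm]
    refine Measure.integrableOn_of_bounded (M := D * (‖x‖ / 2)⁻¹) measure_ball_lt_top.ne
      hg.aestronglyMeasurable ?_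
    filter_upwards [ae_restrict_mem hBm] with y hy
    rw [hB, mem_ball, dist_eq_norm, norm_sub_rev] at hy
    have h1 := half_norm_le_of_sub_lt hy
    have hy0 : y ≠ 0 := norm_pos_iff.1 (lt_of_lt_of_le (by positivity) h1)
    refine (hD y hy0).trans ?_
    gcongr
  have hcont₁ : ContinuousAt (B.indicator g) x := by
    refine hgx.congr ?_
    filter_upwards [isOpen_ball.mem_nhds hxB] with y hy
    rw [indicator_of_mem hy]
  have hker : ∀ c : ℝ, 0 < c → ∀ y, (n + 1) * c⁻¹ ^ 2 / regDist x c⁻¹ y ^ (n + 3)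
      = omega_n n * (c ^ (n + 1) * ((omega_n n)⁻¹ * ((n + 1) /
        √(‖c • (x - y)‖ ^ 2 + 1) ^ (n + 3)))) := by
    intro c hc y
    have h1 : √(‖c • (x - y)‖ ^ 2 + 1) = c * regDist x c⁻¹ y := by
      rw [regDist, norm_smul, Real.norm_of_nonneg hc.le,
        show (c * ‖x - y‖) ^ 2 + 1 = c ^ 2 * (‖x - y‖ ^ 2 + c⁻¹ ^ 2) by field_simp,
        Real.sqrt_mul (by positivity), Real.sqrt_sq hc.le]
    have hr := regDist_pos (x := x) (inv_pos.2 hc) y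
    rw [h1]
    field_simp
    ring
  have hlim₁ : Tendsto (fun c : ℝ => ∫ y, (n + 1) * c⁻¹ ^ 2 / regDist x c⁻¹ y ^ (n + 3)
      * B.indicator g y) atTop (𝓝 (omega_n n * g x)) := by
    have hpeak := tendsto_integral_comp_smul_smul_of_integrable'
      (μ := (volume : Measure (EuclideanSpace ℝ (Fin (n + 1)))))
      (φ := fun z => (omega_n n)⁻¹ * ((n + 1) / √(‖z‖ ^ 2 + 1) ^ (n + 3)))
      (fun z => by positivity) (by rw [integral_const_mul, integral_poisson_kernel,
        inv_mul_cancel₀ hω.ne']) ?_ hint₁ hcont₁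
    · rw [indicator_of_mem hxB] at hpeak
      refine (hpeak.const_mul (omega_n n)).congr' ?_
      filter_upwards [eventually_gt_atTop 0] with c hc
      rw [← integral_const_mul]
      congr 1
      ext y
      rw [hker c hc y]
      simp only [finrank_euclideanSpace, Fintype.card_fin, smul_eq_mul]
      ring
    · have hlim : Tendsto (fun z : EuclideanSpace ℝ (Fin (n + 1)) =>
          (omega_n n)⁻¹ * (n + 1) * ‖z‖⁻¹) (Bornology.cobounded _) (𝓝 0) := by
        simpa using (tendsto_inv_atTop_zero.comp tendsto_norm_cobounded_atTop).const_mul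
          ((omega_n n)⁻¹ * ((n : ℝ) + 1))
      refine squeeze_zero' (Eventually.of_forall fun z => by positivity) ?_ hlim
      filter_upwards [tendsto_norm_cobounded_atTop.eventually_ge_atTop 1] with z hz
      have hs : ‖z‖ ≤ √(‖z‖ ^ 2 + 1) := Real.le_sqrt_of_sq_le (by linarith)
      simp only [finrank_euclideanSpace, Fintype.card_fin]
      have hz0 : 0 < ‖z‖ := by linarith
      have hpow : ‖z‖ ^ (n + 2) ≤ √(‖z‖ ^ 2 + 1) ^ (n + 3) :=
        (pow_le_pow_right₀ hz (by omega)).trans (pow_le_pow_left₀ hz0.le hs (n + 3))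
      calc _ ≤ ‖z‖ ^ (n + 1) * ((omega_n n)⁻¹ * ((n + 1) / ‖z‖ ^ (n + 2))) := by gcongr
        _ = _ := by field_simp; ring
  set A := 2 * (1 + ‖x‖) / ‖x‖ + 1 with hA
  have hA0 : 0 < A := by positivity
  have hdom : Integrable fun y : EuclideanSpace ℝ (Fin (n + 1)) =>
      ((1 + ‖y‖) ^ (n + 1) * ‖y‖ ^ 1)⁻¹ :=
    integrable_inv_one_add_norm_pow_mul_norm_pow (by simpa using hn) (by simp)
  have hne : ∀ᵐ y : EuclideanSpace ℝ (Fin (n + 1)), y ≠ 0 := by simp [ae_iff, measure_singleton]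
  have hbound₂ : ∀ c : ℝ, 0 < c → ∀ᵐ y : EuclideanSpace ℝ (Fin (n + 1)),
      ‖(n + 1) * c⁻¹ ^ 2 / regDist x c⁻¹ y ^ (n + 3) * Bᶜ.indicator g y‖
        ≤ c⁻¹ ^ 2 * ((n + 1) * D * A ^ (n + 3) * ((1 + ‖y‖) ^ (n + 1) * ‖y‖ ^ 1)⁻¹) := by
    intro c hc
    filter_upwards [hne] with y hy
    by_cases hyB : y ∈ B
    · rw [indicator_of_notMem (by simpa using hyB)]
      simp only [mul_zero, norm_zero]
      positivity
    rw [indicator_of_mem hyB]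
    rw [hB, mem_ball, dist_eq_norm, norm_sub_rev, not_lt] at hyB
    have h1 := one_add_norm_le_of_half_norm_le hx hyB
    have hr := regDist_pos (x := x) (inv_pos.2 hc) y
    have h2 : (regDist x c⁻¹ y ^ (n + 3))⁻¹ ≤ A ^ (n + 3) * ((1 + ‖y‖) ^ (n + 1))⁻¹ := by
      rw [← div_eq_mul_inv, le_div_iff₀ (by positivity), inv_mul_le_iff₀ (by positivity),
        mul_comm, ← mul_pow]
      calc (1 + ‖y‖) ^ (n + 1) ≤ (1 + ‖y‖) ^ (n + 3) :=
            pow_le_pow_right₀ (by linarith [norm_nonneg y]) (by omega)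
        _ ≤ _ := by
            gcongr
            exact h1.trans (by gcongr; exact norm_sub_le_regDist y)
    rw [norm_mul, norm_div, Real.norm_of_nonneg (by positivity),
      Real.norm_of_nonneg (by positivity), div_eq_mul_inv, Real.norm_eq_abs]
    calc _ ≤ (n + 1) * c⁻¹ ^ 2 * (A ^ (n + 3) * ((1 + ‖y‖) ^ (n + 1))⁻¹) * (D * ‖y‖⁻¹) := by
          gcongr; exact hD y hy
      _ = _ := by rw [mul_inv, pow_one]; ring
  have hlim₂ : Tendsto (fun c : ℝ => ∫ y, (n + 1) * c⁻¹ ^ 2 / regDist x c⁻¹ y ^ (n + 3)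
      * Bᶜ.indicator g y) atTop (𝓝 0) := by
    have h0 : Tendsto (fun c : ℝ => c⁻¹ ^ 2 * ∫ y : EuclideanSpace ℝ (Fin (n + 1)),
        (n + 1) * D * A ^ (n + 3) * ((1 + ‖y‖) ^ (n + 1) * ‖y‖ ^ 1)⁻¹) atTop (𝓝 0) := by
      have h := ((tendsto_inv_atTop_zero (𝕜 := ℝ)).pow 2).mul_const
        (∫ y : EuclideanSpace ℝ (Fin (n + 1)),
          (n + 1) * D * A ^ (n + 3) * ((1 + ‖y‖) ^ (n + 1) * ‖y‖ ^ 1)⁻¹)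
      rwa [zero_pow two_ne_zero, zero_mul] at h
    refine squeeze_zero_norm' ?_ h0
    filter_upwards [eventually_gt_atTop 0] with c hc
    rw [← integral_const_mul]
    exact norm_integral_le_of_norm_le ((hdom.const_mul _).const_mul _) (hbound₂ c hc)
  have hsum := hlim₁.add hlim₂
  rw [add_zero] at hsum
  refine hsum.congr' ?_
  filter_upwards [eventually_gt_atTop 0] with c hc
  have hkc : Continuous fun y => (n + 1) * c⁻¹ ^ 2 / regDist x c⁻¹ y ^ (n + 3) :=
    continuous_const.div ((contDiff_regDist (inv_pos.2 hc)).continuous.pow _)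
      fun y => (pow_pos (regDist_pos (inv_pos.2 hc) y) _).ne'
  rw [← integral_add]
  · congr 1
    ext y
    rw [← mul_add, indicator_self_add_compl_apply]
  · refine hint₁.bdd_mul (c := (n + 1) * c⁻¹ ^ 2 / c⁻¹ ^ (n + 3)) hkc.aestronglyMeasurable
      (Eventually.of_forall fun y => ?_)
    have hr := regDist_pos (x := x) (inv_pos.2 hc) y
    rw [Real.norm_of_nonneg (by positivity)]
    gcongr
    exact le_regDist y
  · exact Integrable.mono' ((hdom.const_mul _).const_mul _)
      (hkc.aestronglyMeasurable.mul (hg.indicator hBm.compl).aestronglyMeasurable) (hbound₂ c hc)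

end Kernel

/-- the second derivatives of the solution are given by the
fundamental solution of the Laplace equation. -/
theorem stmt_3 (n : ℕ) (hn : 2 ≤ n)
    (f u : EuclideanSpace ℝ (Fin (n + 1)) → ℝ) (K : NNReal)
    (hf_pos : ∀ x ∈ sphere (0 : EuclideanSpace ℝ (Fin (n + 1))) 1, 0 < f x)
    (hf_lip : LipschitzOnWith K f (sphere (0 : EuclideanSpace ℝ (Fin (n + 1))) 1))
    (hf_hom : ∀ t : ℝ, 0 < t → ∀ y : EuclideanSpace ℝ (Fin (n + 1)), y ≠ 0 →
      f (t • y) = t⁻¹ * f y)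
    (hu_cont : Continuous u)
    (hu_hom : ∀ t : ℝ, 0 < t → ∀ y : EuclideanSpace ℝ (Fin (n + 1)), y ≠ 0 →
      u (t • y) = t * u y)
    (hu_C2 : ContDiffOn ℝ 2 u {(0 : EuclideanSpace ℝ (Fin (n + 1)))}ᶜ)
    (hu_lap : ∀ x : EuclideanSpace ℝ (Fin (n + 1)), x ≠ 0 → laplacian u x = f x)
    (x : EuclideanSpace ℝ (Fin (n + 1))) (hx : x ≠ 0) (i j : Fin (n + 1)) :
    Integrable (fun y : EuclideanSpace ℝ (Fin (n + 1)) =>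
        (x j - y j) * fderiv ℝ f y (EuclideanSpace.single i 1) / ‖x - y‖ ^ (n + 1))
    ∧ secondPartial u i j x =
        (1 / omega_n n) * ∫ y : EuclideanSpace ℝ (Fin (n + 1)),
          (x j - y j) * fderiv ℝ f y (EuclideanSpace.single i 1) / ‖x - y‖ ^ (n + 1) := by
  have hf_lip' : LocallyLipschitzOn {0}ᶜ f := by
    obtain ⟨M, hM⟩ := (isCompact_sphere (0 : EuclideanSpace ℝ (Fin (n + 1)))
      1).exists_bound_of_continuousOn hf_lip.continuousOn
    exact locallyLipschitzOn_of_homogeneous hf_lip hM hf_hom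
  have hf_hom' : ∀ t : ℝ, 0 < t → ∀ y : EuclideanSpace ℝ (Fin (n + 1)), y ≠ 0 →
      f (t • y) = t ^ (-((1 : ℕ) : ℤ)) * f y := by simpa using hf_hom
  obtain ⟨⟨D, hD⟩, D', hD'⟩ := exists_decay_of_homogeneous hf_lip' hf_hom'
    (EuclideanSpace.single i 1)
  have hint := integrable_kernel_mul hn hx j
    (measurable_fderiv_apply_const ℝ f (EuclideanSpace.single i 1)) hD'
  refine ⟨hint, ?_⟩
  let w : Fin (n + 1) → EuclideanSpace ℝ (Fin (n + 1)) → ℝ :=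
    fun k y => fderiv ℝ u y (EuclideanSpace.single k 1)
  have hw : ∀ k, ContDiffOn ℝ 1 (w k) {0}ᶜ := fun k => hu_C2.fderiv_apply_compl_zero _
  have hw_lip : ∀ k, LocallyLipschitzOn {0}ᶜ (w k) := fun k =>
    (hw k).locallyLipschitzOn_of_isOpen isOpen_compl_singleton
  have hw_hom : ∀ k, ∀ t : ℝ, 0 < t → ∀ y : EuclideanSpace ℝ (Fin (n + 1)), y ≠ 0 →
      w k (t • y) = t ^ (-((0 : ℕ) : ℤ)) * w k y := by
    intro k t ht y hy
    have := fderiv_apply_smul_of_homogeneous (d := 1) (by simpa using hu_hom)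
      (EuclideanSpace.single k 1) t ht y hy
    simpa using this
  have hsymm : ∀ y, y ≠ 0 → ∀ k l : Fin (n + 1),
      fderiv ℝ (w k) y (EuclideanSpace.single l 1)
        = fderiv ℝ (w l) y (EuclideanSpace.single k 1) := by
    intro y hy k l
    have hc : ContDiffAt ℝ 2 u y := hu_C2.contDiffAt (isOpen_compl_singleton.mem_nhds hy)
    have hdiff : DifferentiableAt ℝ (fderiv ℝ u) y :=
      (hc.fderiv_right (m := 1) (by norm_num)).differentiableAt (by simp)
    have hval : ∀ k l : Fin (n + 1), fderiv ℝ (w k) y (EuclideanSpace.single l 1)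
        = fderiv ℝ (fderiv ℝ u) y (EuclideanSpace.single l 1) (EuclideanSpace.single k 1) := by
      intro k l
      simp only [w]
      rw [fderiv_clm_apply hdiff (differentiableAt_const _)]
      simp
    rw [hval, hval]
    exact hc.isSymmSndFDerivAt (by simp) _ _
  have hne : ∀ᵐ y : EuclideanSpace ℝ (Fin (n + 1)), y ≠ 0 := by simp [ae_iff, measure_singleton]
  have hess_parts : ∀ ε : ℝ, 0 < ε → ∀ a b k l : Fin (n + 1),
      Integrable (fun y => regHess x ε a b y * fderiv ℝ (w l) y (EuclideanSpace.single k 1)) ∧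
      Integrable (fun y => regThird x ε a b k y * w l y) ∧
      ∫ y, regHess x ε a b y * fderiv ℝ (w l) y (EuclideanSpace.single k 1)
        = ∫ y, regThird x ε a b k y * w l y := by
    intro ε hε a b k l
    obtain ⟨⟨F, hF⟩, F', hF'⟩ := exists_decay_of_homogeneous (hw_lip l) (hw_hom l)
      (EuclideanSpace.single k 1)
    obtain ⟨h1, h2, h3⟩ := Integrable.integral_mul_fderiv_eq_of_decay (a := n + 1) (b := 0)
      (C := (n + 2) * ((1 + ‖x‖) / ε + 1) ^ (n + 1))
      (C' := (n + 1) * (n + 6) * ((1 + ‖x‖) / ε + 1) ^ (n + 2))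
      (EuclideanSpace.single k 1) (by omega) (by omega)
      (contDiff_regHess (x := x) hε a b) (hw_lip l)
      (fun y => (abs_regHess_le hε y a b).trans (by
        rw [mul_assoc]; gcongr; exact inv_regDist_pow_le hε y _))
      (fun y => by
        rw [fderiv_regHess hε, abs_neg]
        refine (abs_regThird_le hε y a b k).trans ?_
        rw [mul_assoc _ (_ ^ (n + 2))]; gcongr; exact inv_regDist_pow_le hε y _) hF hF'
    simp only [fderiv_regHess hε, neg_mul, integral_neg, neg_neg] at h2 h3
    exact ⟨h1, by simpa using h2.neg, h3⟩
  have grad_parts : ∀ ε : ℝ, 0 < ε →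
      ∫ y, regGrad x ε j y * fderiv ℝ f y (EuclideanSpace.single i 1)
        = ∫ y, regHess x ε i j y * f y := by
    intro ε hε
    obtain ⟨-, -, h3⟩ := Integrable.integral_mul_fderiv_eq_of_decay (a := n) (b := 1)
      (C := ((1 + ‖x‖) / ε + 1) ^ n)
      (C' := (n + 2) * ((1 + ‖x‖) / ε + 1) ^ (n + 1))
      (EuclideanSpace.single i 1) (by omega) (by omega)
      (contDiff_regGrad (x := x) hε j) hf_lip'
      (fun y => (abs_regGrad_le hε y j).trans (inv_regDist_pow_le hε y _))
      (fun y => by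
        rw [fderiv_regGrad hε, abs_neg]
        refine (abs_regHess_le hε y i j).trans ?_
        rw [mul_assoc]; gcongr; exact inv_regDist_pow_le hε y _) hD hD'
    simpa only [fderiv_regGrad hε, neg_mul, integral_neg, neg_neg] using h3
  have hreg : ∀ ε : ℝ, 0 < ε →
      ∫ y, regGrad x ε j y * fderiv ℝ f y (EuclideanSpace.single i 1)
        = ∫ y, (n + 1) * ε ^ 2 / regDist x ε y ^ (n + 3)
          * fderiv ℝ (w i) y (EuclideanSpace.single j 1) := by
    intro ε hε
    calc ∫ y, regGrad x ε j y * fderiv ℝ f y (EuclideanSpace.single i 1)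
        = ∫ y, regHess x ε i j y * f y := grad_parts ε hε
      _ = ∫ y, ∑ k, regHess x ε i j y * fderiv ℝ (w k) y (EuclideanSpace.single k 1) := by
          refine integral_congr_ae ?_
          filter_upwards [hne] with y hy
          rw [← hu_lap y hy, laplacian, Finset.mul_sum]
      _ = ∑ k, ∫ y, regHess x ε i j y * fderiv ℝ (w k) y (EuclideanSpace.single k 1) :=
          integral_finsetSum _ fun k _ => (hess_parts ε hε i j k k).1
      _ = ∑ k, ∫ y, regHess x ε k k y * fderiv ℝ (w i) y (EuclideanSpace.single j 1) := by
          refine Finset.sum_congr rfl fun k _ => ?_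
          rw [(hess_parts ε hε i j k k).2.2, regThird_swap, ← (hess_parts ε hε k j i k).2.2,
            (hess_parts ε hε k k j i).2.2, regThird_swap', ← (hess_parts ε hε k j k i).2.2]
          refine integral_congr_ae ?_
          filter_upwards [hne] with y hy
          rw [hsymm y hy]
      _ = ∫ y, ∑ k, regHess x ε k k y * fderiv ℝ (w i) y (EuclideanSpace.single j 1) :=
          (integral_finsetSum _ fun k _ => (hess_parts ε hε k k j i).1).symm
      _ = _ := by
          congr 1
          ext y
          rw [← Finset.sum_mul, sum_regHess hε]
  obtain ⟨-, G, hG⟩ := exists_decay_of_homogeneous (hw_lip i) (hw_hom i)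
    (EuclideanSpace.single j 1)
  have hcont : ContinuousAt (fun y => fderiv ℝ (w i) y (EuclideanSpace.single j 1)) x :=
    (((hw i).continuousOn_fderiv_of_isOpen isOpen_compl_singleton le_rfl).clm_apply
      continuousOn_const).continuousAt (isOpen_compl_singleton.mem_nhds hx)
  have hlim₁ := tendsto_integral_regGrad_mul j
    (measurable_fderiv_apply_const ℝ f (EuclideanSpace.single i 1)) hint
  have hlim₂ := tendsto_integral_poisson_mul (by omega) hx
    (measurable_fderiv_apply_const ℝ (w i) (EuclideanSpace.single j 1)) hcont
    (by simpa using hG)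
  have heq := tendsto_nhds_unique (hlim₁.congr' (by
    filter_upwards [Filter.eventually_gt_atTop 0] with c hc using hreg _ (inv_pos.2 hc))) hlim₂
  rw [heq, one_div, inv_mul_cancel_left₀ (omega_n_pos n).ne']
  rfl
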